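/- For every positive integer n, let v_n = n·X_n + n·X_{−n} + (2n−1)·X_{−1} + 3n·Y_0 ∈ G_ℤ. Then the R-length of v_n is at least 2n² + 3n − 2; that is, every finite list of elements of R whose sum equals v_n has length at least 2n² + 3n − 2. -/

import Mathlib

/-- `X k` is the basis element of the free abelian group on `Bool × ℤ` indexed by `(true, k)`. -/
def X (k : ℤ) : FreeAbelianGroup (Bool × ℤ) := FreeAbelianGroup.of (true, k)

/-- `Y k` is the basis element of the free abelian group on `Bool × ℤ` indexed by `(false, k)`. -/
def Y (k : ℤ) : FreeAbelianGroup (Bool × ℤ) := FreeAbelianGroup.of (false, k)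

/-- The set of elements of the forms `X 0`, `Y 0`, `X k + Y k`, `X k + Y (k+1)`,
`X k - X (k+1)`, `Y k - Y (k+1)`. -/
def R₀ : Set (FreeAbelianGroup (Bool × ℤ)) :=
  {v | v = X 0 ∨ v = Y 0 ∨ (∃ k : ℤ, v = X k + Y k) ∨ (∃ k : ℤ, v = X k + Y (k + 1)) ∨
       (∃ k : ℤ, v = X k - X (k + 1)) ∨ (∃ k : ℤ, v = Y k - Y (k + 1))}

/-- `R` consists of the elements of `R₀` together with their negatives. -/
def R : Set (FreeAbelianGroup (Bool × ℤ)) := R₀ ∪ (-R₀)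

/-- The element `v n = n·Xₙ + n·X₋ₙ + (2n−1)·X₋₁ + 3n·Y₀`. -/
def v (n : ℤ) : FreeAbelianGroup (Bool × ℤ) :=
  n • X n + n • X (-n) + (2 * n - 1) • X (-1) + (3 * n) • Y 0

/-- Dual potential: distance to the set consisting of the base point and `-Y 0`. -/
noncomputable def pot : FreeAbelianGroup (Bool × ℤ) →+ ℤ :=
  FreeAbelianGroup.lift (fun p => if p.1 = true then max (p.2 + 1) (-p.2) else -|p.2|)

lemma pot_X (k : ℤ) : pot (X k) = max (k + 1) (-k) := by
  simp [pot, X]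

lemma pot_Y (k : ℤ) : pot (Y k) = -|k| := by
  simp [pot, Y]

lemma pot_R₀ (y : FreeAbelianGroup (Bool × ℤ)) (hy : y ∈ R₀) : |pot y| ≤ 1 := by
  rcases hy with h | h | ⟨k, h⟩ | ⟨k, h⟩ | ⟨k, h⟩ | ⟨k, h⟩ <;> subst h <;>
    simp only [map_add, map_sub, pot_X, pot_Y, abs_le, abs_eq_max_neg] <;> omega

lemma pot_R (y : FreeAbelianGroup (Bool × ℤ)) (hy : y ∈ R) : |pot y| ≤ 1 := by
  rcases hy with h | h
  · exact pot_R₀ y h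
  · have := pot_R₀ (-y) h
    simpa using this

lemma pot_list (l : List (FreeAbelianGroup (Bool × ℤ))) (hl : ∀ y ∈ l, y ∈ R) :
    pot l.sum ≤ (l.length : ℤ) := by
  induction l with
  | nil => simp
  | cons a t ih =>
    have h1 := ih (fun y hy => hl y (List.mem_cons_of_mem _ hy))
    have h2 := (abs_le.mp (pot_R a (hl a List.mem_cons_self))).2
    simp only [List.sum_cons, map_add, List.length_cons]
    push_cast
    linarith

theorem R_length_v_ge (n : ℤ) (hn : 0 < n) (l : List (FreeAbelianGroup (Bool × ℤ)))
    (hl : ∀ y ∈ l, y ∈ R) (hsum : l.sum = v n) :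
    2 * n ^ 2 + 3 * n - 2 ≤ (l.length : ℤ) := by
  have h := pot_list l hl
  rw [hsum] at h
  have h1 : max (n + 1) (-n) = n + 1 := max_eq_left (by omega)
  have h2 : max (-n + 1) (- -n) = n := by rw [neg_neg]; exact max_eq_right (by omega)
  simp only [v, map_add, map_zsmul, pot_X, pot_Y, h1, h2, smul_eq_mul] at h
  norm_num at h
  nlinarith
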